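/- Let K be a commutative ring, t ≥ 1, and let R be a fence on r₁, …, r_t (for each 1 ≤ i < t one chosen generating relation, either r_i ≺ r_{i+1} or r_{i+1} ≺ r_i). Let m ≥ 2, h ≥ 2, take fresh elements σ₁, …, σ_m and η₁, …, η_h, and fix weights u_i = w(r_i), s_i = w(σ_i), v_j = w(η_j) in K. Define: P on {r₁, …, r_t} ∪ {σ's} ∪ {η's} with the fence relations of R, the chains σ₁ ≺ ⋯ ≺ σ_m and η₁ ≺ ⋯ ≺ η_h, and σ₁ ≺ r₁, r₁ ≺ σ_m, η₁ ≺ r_t, r_t ≺ η_h; P_p on {r's} ∪ {σ's} with the fence relations of R, the σ-chain, and σ₁ ≺ r₁, r₁ ≺ σ_m; and P_q on {r's} ∪ {η's} with the fence relations of R, the η-chain, and η₁ ≺ r_t, r_t ≺ η_h. Then Z(R) · Z(P) − Z(P_p) · Z(P_q) = (∏_{i=1}^{t} u_i) · (1 − ∏_{i=1}^{m} s_i) · (1 − ∏_{j=1}^{h} v_j), where Z(R) is the sum over down-sets of the fence R of the product of the weights of their elements. -/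

import Mathlib

/-!
The combinatorial content of Corollary 4.6 of the paper (a generalization of
Musiker–Schiffler–Williams' Theorem 12.9 to possibly self-intersecting arcs), in the
down-set formalism: for a plain arc `γ` incident to two punctures `p` and `q`,
`Z(R) · Z(P) − Z(P_p) · Z(P_q) = (∏ u_i) · (1 − ∏ s_i) · (1 − ∏ v_j)`,
where `R` is the fence poset of `γ`, `P` is the poset of the doubly-notched arc
`γ^{(p,q)}`, and `P_p`, `P_q` are the posets of the two singly-notched arcs;
`σ₁, …, σ_m` and `η₁, …, η_h` are the spokes at `p` and `q`.
-/

attribute [local instance] Classical.propDecidable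

noncomputable section

/-- The ideal sum of a configuration: the sum, over all down-sets `S` of the ground set
(`S ⊆ ground`, closed under the generating relations: `rel x y` with `x ∈ ground` and
`y ∈ S` implies `x ∈ S`), of the product of the weights of the elements of `S`. -/
def idealSum {α K : Type*} [CommSemiring K]
    (ground : Finset α) (rel : α → α → Prop) (w : α → K) : K :=
  ∑ S ∈ ground.powerset.filter
      (fun S => ∀ x ∈ ground, ∀ y ∈ S, rel x y → x ∈ S),
    ∏ x ∈ S, w x

/-- The generating chain `f lo ≺ f (lo+1) ≺ ⋯ ≺ f hi`. -/
def chainRel {α : Type*} (f : ℕ → α) (lo hi : ℕ) : α → α → Prop :=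
  fun p q => ∃ i, lo ≤ i ∧ i + 1 ≤ hi ∧ p = f i ∧ q = f (i + 1)

/-- The single generating relation `u ≺ v`. -/
def covRel {α : Type*} (u v : α) : α → α → Prop := fun p q => p = u ∧ q = v

/-- A fence on `f 1, …, f t`: for each `1 ≤ i < t` one chosen generating relation,
either `f i ≺ f (i+1)` (when `ε i = true`) or `f (i+1) ≺ f i` (when `ε i = false`). -/
def fenceRel {α : Type*} (f : ℕ → α) (t : ℕ) (ε : ℕ → Bool) : α → α → Prop :=
  fun p q => ∃ i, 1 ≤ i ∧ i + 1 ≤ t ∧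
    ((ε i = true ∧ p = f i ∧ q = f (i + 1)) ∨
     (ε i = false ∧ p = f (i + 1) ∧ q = f i))

/-- The elements `f lo, …, f hi`. -/
def natGround {α : Type*} (f : ℕ → α) (lo hi : ℕ) : Finset α := (Finset.Icc lo hi).image f

/-- The fence elements `r₁, …, r_t`. -/
def er : ℕ → ℕ ⊕ (ℕ ⊕ ℕ) := fun i => Sum.inl i

/-- The spokes `σ₁, …, σ_m` at `p`. -/
def es : ℕ → ℕ ⊕ (ℕ ⊕ ℕ) := fun i => Sum.inr (Sum.inl i)

/-- The spokes `η₁, …, η_h` at `q`. -/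
def ee : ℕ → ℕ ⊕ (ℕ ⊕ ℕ) := fun j => Sum.inr (Sum.inr j)

/-- `S` is closed under the generating relations with source in `ground`. -/
def IsDown {α : Type*} (ground : Finset α) (rel : α → α → Prop) (S : Finset α) : Prop :=
  ∀ x ∈ ground, ∀ y ∈ S, rel x y → x ∈ S

/-- The ideal sum in which each down-set `S` carries the additional factor `φ S`. -/
def weightedIdealSum {α K : Type*} [CommSemiring K]
    (ground : Finset α) (rel : α → α → Prop) (w : α → K) (φ : Finset α → K) : K :=
  ∑ S ∈ ground.powerset, if IsDown ground rel S then (∏ x ∈ S, w x) * φ S else 0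

/-- The sum over the down-sets of the chain `f 1 ≺ ⋯ ≺ f m` compatible with the relations
`f 1 ≺ c ≺ f m`, where the truth value `a` records whether `c` belongs to the down-set. -/
def loopSum {α K : Type*} [CommSemiring K] (f : ℕ → α) (m : ℕ) (w : α → K) (a : Prop) : K :=
  ∑ T ∈ (natGround f 1 m).powerset,
    if IsDown (natGround f 1 m) (chainRel f 1 m) T ∧ (a → f 1 ∈ T) ∧ (f m ∈ T → a)
    then ∏ x ∈ T, w x else 0

lemma idealSum_eq_weightedIdealSum {α K : Type*} [CommSemiring K]
    (ground : Finset α) (rel : α → α → Prop) (w : α → K) :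
    idealSum ground rel w = weightedIdealSum ground rel w (fun _ => 1) := by
  simp only [idealSum, weightedIdealSum, Finset.sum_filter, mul_one, IsDown]
  congr!

lemma mem_natGround {α : Type*} {f : ℕ → α} {lo hi : ℕ} {x : α} :
    x ∈ natGround f lo hi ↔ ∃ i, lo ≤ i ∧ i ≤ hi ∧ f i = x := by
  simp [natGround, and_assoc]

lemma natGround_succ {α : Type*} (f : ℕ → α) (t : ℕ) :
    natGround f 1 (t + 1) = insert (f (t + 1)) (natGround f 1 t) := by
  ext x
  simp only [Finset.mem_insert, mem_natGround]
  constructor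
  · rintro ⟨i, h1, h2, rfl⟩
    rcases Nat.lt_or_ge t i with h | h
    · left; congr 1; omega
    · exact Or.inr ⟨i, h1, h, rfl⟩
  · rintro (rfl | ⟨i, h1, h2, rfl⟩)
    · exact ⟨t + 1, by omega, le_rfl, rfl⟩
    · exact ⟨i, h1, by omega, rfl⟩

lemma sum_powerset_union {α K : Type*} [DecidableEq α] [AddCommMonoid K] {G H : Finset α}
    (hd : Disjoint G H) (g : Finset α → K) :
    ∑ S ∈ (G ∪ H).powerset, g S = ∑ S ∈ G.powerset, ∑ T ∈ H.powerset, g (S ∪ T) := by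
  rw [← Finset.sum_product']
  rw [Finset.disjoint_left] at hd
  refine Finset.sum_bij' (fun S _ => (S ∩ G, S ∩ H)) (fun p _ => p.1 ∪ p.2) ?_ ?_ ?_ ?_ ?_
  · intro S _
    simp
  · intro p hp
    simp only [Finset.mem_product, Finset.mem_powerset] at hp ⊢
    exact Finset.union_subset_union hp.1 hp.2
  · intro S hS
    rw [Finset.mem_powerset] at hS
    rw [← Finset.inter_union_distrib_left, Finset.inter_eq_left.2 hS]
  · intro p hp
    simp only [Finset.mem_product, Finset.mem_powerset, Finset.subset_iff] at hp
    ext x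
    · simp only [Finset.mem_inter, Finset.mem_union]
      have := @hp.1 x; have := @hp.2 x; have := @hd x
      tauto
    · simp only [Finset.mem_inter, Finset.mem_union]
      have := @hp.1 x; have := @hp.2 x; have := @hd x
      tauto
  · intro S hS
    rw [Finset.mem_powerset] at hS
    rw [← Finset.inter_union_distrib_left, Finset.inter_eq_left.2 hS]

lemma isDown_union_loop {α : Type*} [DecidableEq α] {G : Finset α} {rel : α → α → Prop}
    {f : ℕ → α} {m : ℕ} {c : α} (hm : 1 ≤ m) (hrel : ∀ x y, rel x y → x ∈ G ∧ y ∈ G) (hc : c ∈ G)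
    (hf : ∀ i, f i ∉ G) {S T : Finset α} (hS : S ⊆ G) (hT : T ⊆ natGround f 1 m) :
    IsDown (G ∪ natGround f 1 m)
        (rel ⊔ chainRel f 1 m ⊔ covRel (f 1) c ⊔ covRel c (f m)) (S ∪ T) ↔
      IsDown G rel S ∧ IsDown (natGround f 1 m) (chainRel f 1 m) T ∧
        (c ∈ S → f 1 ∈ T) ∧ (f m ∈ T → c ∈ S) := by
  have hTG : ∀ x ∈ T, x ∉ G := by
    intro x hx
    obtain ⟨i, -, -, rfl⟩ := mem_natGround.1 (hT hx)
    exact hf i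
  have hfS : ∀ i, f i ∉ S := fun i h => hf i (hS h)
  have hfm : ∀ i, 1 ≤ i → i ≤ m → f i ∈ natGround f 1 m := fun i h1 h2 =>
    mem_natGround.2 ⟨i, h1, h2, rfl⟩
  constructor
  · intro h
    refine ⟨?_, ?_, ?_, ?_⟩
    · intro x hx y hy hxy
      have := h x (Finset.mem_union_left _ hx) y (Finset.mem_union_left _ hy)
        (Or.inl (Or.inl (Or.inl hxy)))
      exact (Finset.mem_union.1 this).resolve_right (fun h' => hTG x h' hx)
    · intro x hx y hy hxy
      have := h x (Finset.mem_union_right _ hx) y (Finset.mem_union_right _ hy)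
        (Or.inl (Or.inl (Or.inr hxy)))
      obtain ⟨i, -, -, rfl⟩ := mem_natGround.1 hx
      exact (Finset.mem_union.1 this).resolve_left (hfS i)
    · intro hcS
      have := h (f 1) (Finset.mem_union_right _ (hfm 1 le_rfl hm)) c
        (Finset.mem_union_left _ hcS) (Or.inl (Or.inr ⟨rfl, rfl⟩))
      exact (Finset.mem_union.1 this).resolve_left (hfS 1)
    · intro hmT
      have := h c (Finset.mem_union_left _ hc) (f m)
        (Finset.mem_union_right _ hmT) (Or.inr ⟨rfl, rfl⟩)
      exact (Finset.mem_union.1 this).resolve_right (fun h' => hTG c h' hc)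
  · rintro ⟨h1, h2, h3, h4⟩ x - y hy (((hxy | hxy) | ⟨rfl, rfl⟩) | ⟨rfl, rfl⟩)
    · have hy' := (Finset.mem_union.1 hy).resolve_right (fun h' => hTG y h' (hrel x y hxy).2)
      exact Finset.mem_union_left _ (h1 x (hrel x y hxy).1 y hy' hxy)
    · obtain ⟨i, hi, hi', rfl, rfl⟩ := hxy
      have hy' := (Finset.mem_union.1 hy).resolve_left (hfS _)
      exact Finset.mem_union_right _
        (h2 _ (hfm i hi (by omega)) _ hy' ⟨i, hi, hi', rfl, rfl⟩)
    · have hy' := (Finset.mem_union.1 hy).resolve_right (fun h' => hTG _ h' hc)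
      exact Finset.mem_union_right _ (h3 hy')
    · have hy' := (Finset.mem_union.1 hy).resolve_left (hfS _)
      exact Finset.mem_union_left _ (h4 hy')

/-- Attaching a loop `f 1 ≺ ⋯ ≺ f m`, `f 1 ≺ c ≺ f m` at an element `c` inserts the factor
`loopSum` depending only on whether `c` belongs to the down-set. -/
lemma weightedIdealSum_union_loop {α K : Type*} [DecidableEq α] [CommSemiring K] {G : Finset α}
    {rel : α → α → Prop} {f : ℕ → α} {m : ℕ} {c : α} (w : α → K) (φ : Finset α → K)
    (hm : 1 ≤ m) (hrel : ∀ x y, rel x y → x ∈ G ∧ y ∈ G) (hc : c ∈ G) (hf : ∀ i, f i ∉ G)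
    (hφ : ∀ S ⊆ G, ∀ T ⊆ natGround f 1 m, φ (S ∪ T) = φ S) :
    weightedIdealSum (G ∪ natGround f 1 m)
        (rel ⊔ chainRel f 1 m ⊔ covRel (f 1) c ⊔ covRel c (f m)) w φ =
      weightedIdealSum G rel w (fun S => loopSum f m w (c ∈ S) * φ S) := by
  have hd : Disjoint G (natGround f 1 m) := by
    rw [Finset.disjoint_right]
    intro x hx
    obtain ⟨i, -, -, rfl⟩ := mem_natGround.1 hx
    exact hf i
  unfold weightedIdealSum loopSum
  rw [sum_powerset_union hd]
  refine Finset.sum_congr rfl fun S hS => ?_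
  rw [Finset.mem_powerset] at hS
  by_cases hdown : IsDown G rel S
  · beta_reduce
    rw [if_pos hdown, Finset.sum_mul, Finset.mul_sum]
    refine Finset.sum_congr rfl fun T hT => ?_
    rw [Finset.mem_powerset] at hT
    rw [isDown_union_loop hm hrel hc hf hS hT, hφ S hS T hT,
      Finset.prod_union (Finset.disjoint_of_subset_left hS (Finset.disjoint_of_subset_right hT hd))]
    simp only [hdown, true_and]
    split_ifs <;> ring
  · rw [if_neg hdown]
    refine Finset.sum_eq_zero fun T hT => ?_
    rw [Finset.mem_powerset] at hT
    rw [isDown_union_loop hm hrel hc hf hS hT, if_neg (fun h => hdown h.1)]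

lemma loopSum_false_sub_true {α K : Type*} [CommRing K] {f : ℕ → α}
    (hf : Function.Injective f) {m : ℕ} (hm : 1 ≤ m) (w : α → K) :
    loopSum f m w False - loopSum f m w True = 1 - ∏ i ∈ Finset.Icc 1 m, w (f i) := by
  have hfm : ∀ i, 1 ≤ i → i ≤ m → f i ∈ natGround f 1 m := fun i h1 h2 =>
    mem_natGround.2 ⟨i, h1, h2, rfl⟩
  have key : ∀ T ∈ (natGround f 1 m).powerset,
      ((if IsDown (natGround f 1 m) (chainRel f 1 m) T ∧ (False → f 1 ∈ T) ∧ (f m ∈ T → False)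
        then ∏ x ∈ T, w x else 0) -
      (if IsDown (natGround f 1 m) (chainRel f 1 m) T ∧ (True → f 1 ∈ T) ∧ (f m ∈ T → True)
        then ∏ x ∈ T, w x else 0)) =
      (if T = ∅ then ∏ x ∈ T, w x else 0) -
        (if T = natGround f 1 m then ∏ x ∈ T, w x else 0) := by
    intro T hT
    rw [Finset.mem_powerset] at hT
    by_cases hdown : IsDown (natGround f 1 m) (chainRel f 1 m) T
    · have step : ∀ i, 1 ≤ i → i + 1 ≤ m → f (i + 1) ∈ T → f i ∈ T := fun i h1 h2 h3 =>
        hdown _ (hfm i h1 (by omega)) _ h3 ⟨i, h1, h2, rfl, rfl⟩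
      have mono : ∀ k i, 1 ≤ i → i + k ≤ m → f (i + k) ∈ T → f i ∈ T := by
        intro k
        induction k with
        | zero => intro i _ _ h; exact h
        | succ k ih => intro i h1 h2 h; exact ih i h1 (by omega) (step (i + k) (by omega) h2 h)
      have h_empty : T = ∅ ↔ f 1 ∉ T := by
        constructor
        · rintro rfl; simp
        · intro h1
          refine Finset.eq_empty_of_forall_notMem fun x hx => h1 ?_
          obtain ⟨i, hi, hi', rfl⟩ := mem_natGround.1 (hT hx)
          exact mono (i - 1) 1 le_rfl (by omega) (by rwa [Nat.add_sub_cancel' hi])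
      have h_full : T = natGround f 1 m ↔ f m ∈ T := by
        constructor
        · rintro rfl; exact hfm m hm le_rfl
        · intro h1
          refine Finset.Subset.antisymm hT fun x hx => ?_
          obtain ⟨i, hi, hi', rfl⟩ := mem_natGround.1 hx
          exact mono (m - i) i hi (by omega) (by rwa [Nat.add_sub_cancel' hi'])
      have h1m : f m ∈ T → f 1 ∈ T := fun h =>
        mono (m - 1) 1 le_rfl (by omega) (by rwa [Nat.add_sub_cancel' hm])
      simp only [h_empty, h_full]
      by_cases h1 : f 1 ∈ T <;> by_cases h2 : f m ∈ T <;> simp_all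
    · have hne : T ≠ ∅ := by
        rintro rfl
        exact hdown (fun x _ y hy => absurd hy (Finset.notMem_empty y))
      have hnf : T ≠ natGround f 1 m := by
        rintro rfl
        exact hdown (fun x hx _ _ _ => hx)
      simp [hdown, hne, hnf]
  unfold loopSum
  rw [← Finset.sum_sub_distrib, Finset.sum_congr rfl fun T hT => by
      convert key T hT, Finset.sum_sub_distrib,
    Finset.sum_ite_eq', Finset.sum_ite_eq', if_pos (Finset.empty_mem_powerset _),
    if_pos (Finset.mem_powerset_self _), Finset.prod_empty, natGround,
    Finset.prod_image hf.injOn]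

lemma isDown_fence_succ {α : Type*} {f : ℕ → α} (hf : Function.Injective f) {t : ℕ}
    (ht : 1 ≤ t) (ε : ℕ → Bool) {S : Finset α} (hS : S ⊆ natGround f 1 t) :
    IsDown (natGround f 1 (t + 1)) (fenceRel f (t + 1) ε) S ↔
      IsDown (natGround f 1 t) (fenceRel f t ε) S ∧ (ε t = false → f t ∉ S) := by
  have hnot : f (t + 1) ∉ S := by
    intro h
    obtain ⟨i, _, h2, h3⟩ := mem_natGround.1 (hS h)
    have := hf h3
    omega
  have hfm : ∀ n i, 1 ≤ i → i ≤ n → f i ∈ natGround f 1 n := fun n i h1 h2 =>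
    mem_natGround.2 ⟨i, h1, h2, rfl⟩
  constructor
  · intro h
    refine ⟨?_, ?_⟩
    · rintro x - y hy ⟨i, hi, hi', hxy⟩
      refine h x ?_ y hy ⟨i, hi, by omega, hxy⟩
      rcases hxy with ⟨_, rfl, _⟩ | ⟨_, rfl, _⟩ <;> exact hfm _ _ (by omega) (by omega)
    · intro he hft
      exact hnot (h _ (hfm _ _ (by omega) le_rfl) _ hft ⟨t, ht, le_rfl, Or.inr ⟨he, rfl, rfl⟩⟩)
  · rintro ⟨h1, h2⟩ x - y hy ⟨i, hi, hi', hxy⟩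
    rcases Nat.lt_or_ge i t with hit | hit
    · refine h1 x ?_ y hy ⟨i, hi, hit, hxy⟩
      rcases hxy with ⟨_, rfl, _⟩ | ⟨_, rfl, _⟩ <;> exact hfm _ _ (by omega) (by omega)
    · obtain rfl : i = t := by omega
      rcases hxy with ⟨_, rfl, rfl⟩ | ⟨he, rfl, rfl⟩
      · exact absurd hy hnot
      · exact absurd hy (h2 he)

lemma isDown_fence_succ_insert {α : Type*} {f : ℕ → α} (hf : Function.Injective f) {t : ℕ}
    (ht : 1 ≤ t) (ε : ℕ → Bool) {S : Finset α} (hS : S ⊆ natGround f 1 t) :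
    IsDown (natGround f 1 (t + 1)) (fenceRel f (t + 1) ε) (insert (f (t + 1)) S) ↔
      IsDown (natGround f 1 t) (fenceRel f t ε) S ∧ (ε t = true → f t ∈ S) := by
  have hfm : ∀ n i, 1 ≤ i → i ≤ n → f i ∈ natGround f 1 n := fun n i h1 h2 =>
    mem_natGround.2 ⟨i, h1, h2, rfl⟩
  have hins : ∀ i, i ≤ t → (f i ∈ insert (f (t + 1)) S ↔ f i ∈ S) := by
    intro i hi
    rw [Finset.mem_insert, or_iff_right]
    intro h
    have := hf h
    omega
  constructor
  · intro h
    refine ⟨?_, ?_⟩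
    · rintro x - y hy ⟨i, hi, hi', hxy⟩
      have hx : x ∈ insert (f (t + 1)) S := by
        refine h x ?_ y (Finset.mem_insert_of_mem hy) ⟨i, hi, by omega, hxy⟩
        rcases hxy with ⟨_, rfl, _⟩ | ⟨_, rfl, _⟩ <;> exact hfm _ _ (by omega) (by omega)
      rcases hxy with ⟨_, rfl, _⟩ | ⟨_, rfl, _⟩ <;> exact (hins _ (by omega)).1 hx
    · intro he
      exact (hins t le_rfl).1 (h _ (hfm _ _ ht (by omega)) _ (Finset.mem_insert_self _ _)
        ⟨t, ht, le_rfl, Or.inl ⟨he, rfl, rfl⟩⟩)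
  · rintro ⟨h1, h2⟩ x - y hy ⟨i, hi, hi', hxy⟩
    rcases Nat.lt_or_ge i t with hit | hit
    · refine Finset.mem_insert_of_mem (h1 x ?_ y ?_ ⟨i, hi, hit, hxy⟩)
      · rcases hxy with ⟨_, rfl, _⟩ | ⟨_, rfl, _⟩ <;> exact hfm _ _ (by omega) (by omega)
      · rcases hxy with ⟨_, _, rfl⟩ | ⟨_, _, rfl⟩ <;> exact (hins _ (by omega)).1 hy
    · obtain rfl : i = t := by omega
      rcases hxy with ⟨he, rfl, rfl⟩ | ⟨_, rfl, rfl⟩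
      · exact Finset.mem_insert_of_mem (h2 he)
      · exact Finset.mem_insert_self _ _

/-- The ideal sum of a fence, with boundary factors `X` and `Y` depending on whether the first
and the last element belong to the down-set. -/
def fenceSum {α K : Type*} [CommSemiring K] (f : ℕ → α) (t : ℕ) (ε : ℕ → Bool) (w : α → K)
    (X Y : Prop → K) : K :=
  weightedIdealSum (natGround f 1 t) (fenceRel f t ε) w (fun S => X (f 1 ∈ S) * Y (f t ∈ S))

lemma fenceSum_one {α K : Type*} [CommSemiring K] (f : ℕ → α) (ε : ℕ → Bool)
    (w : α → K) (X Y : Prop → K) :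
    fenceSum f 1 ε w X Y = X False * Y False + w (f 1) * (X True * Y True) := by
  have hdown : ∀ S, IsDown (natGround f 1 1) (fenceRel f 1 ε) S := by
    rintro S x - y - ⟨i, hi, hi', -⟩
    omega
  have hg : natGround f 1 1 = insert (f 1) ∅ := by simp [natGround]
  unfold fenceSum weightedIdealSum
  simp only [hdown, if_true]
  rw [hg, Finset.sum_powerset_insert (Finset.notMem_empty _)]
  simp

/-- The transfer matrix of one step of a fence, acting on the boundary factor at its end. -/
def fenceStep {K : Type*} [CommSemiring K] (e : Bool) (a : K) (Y : Prop → K) (b : Prop) : K :=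
  (if e = false → ¬ b then Y False else 0) + (if e = true → b then a * Y True else 0)

lemma fenceSum_succ {α K : Type*} [CommSemiring K] {f : ℕ → α} (hf : Function.Injective f)
    {t : ℕ} (ht : 1 ≤ t) (ε : ℕ → Bool) (w : α → K) (X Y : Prop → K) :
    fenceSum f (t + 1) ε w X Y = fenceSum f t ε w X (fenceStep (ε t) (w (f (t + 1))) Y) := by
  have hnot : f (t + 1) ∉ natGround f 1 t := by
    intro h
    obtain ⟨i, _, h2, h3⟩ := mem_natGround.1 h
    have := hf h3
    omega
  have h1 : f 1 ≠ f (t + 1) := fun h => by have := hf h; omega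
  unfold fenceSum weightedIdealSum
  conv_lhs => rw [natGround_succ f t, Finset.sum_powerset_insert hnot, ← natGround_succ f t]
  rw [← Finset.sum_add_distrib]
  refine Finset.sum_congr rfl fun S hS => ?_
  rw [Finset.mem_powerset] at hS
  have hnS : f (t + 1) ∉ S := fun h => hnot (hS h)
  rw [isDown_fence_succ hf ht ε hS, isDown_fence_succ_insert hf ht ε hS,
    Finset.prod_insert hnS]
  simp only [Finset.mem_insert, h1, false_or, true_or, hnS, fenceStep]
  by_cases hdown : IsDown (natGround f 1 t) (fenceRel f t ε) S
  · simp only [hdown, true_and, if_true]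
    split_ifs <;> ring
  · simp [hdown]

/-- The determinant identity for a fence: its transfer matrix has determinant the product of
all weights. -/
lemma fenceSum_det {α K : Type*} [CommRing K] {f : ℕ → α} (hf : Function.Injective f)
    {t : ℕ} (ht : 1 ≤ t) (ε : ℕ → Bool) (w : α → K) (X X' Y Y' : Prop → K) :
    fenceSum f t ε w X Y * fenceSum f t ε w X' Y' -
        fenceSum f t ε w X Y' * fenceSum f t ε w X' Y =
      (∏ i ∈ Finset.Icc 1 t, w (f i)) * (X False * X' True - X True * X' False) *
        (Y False * Y' True - Y True * Y' False) := by
  induction t, ht using Nat.le_induction generalizing Y Y' with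
  | base =>
    simp only [fenceSum_one, Finset.Icc_self, Finset.prod_singleton]
    ring
  | succ t ht ih =>
    simp only [fenceSum_succ hf ht]
    rw [ih, Finset.prod_Icc_succ_top (by omega)]
    cases ε t <;> simp [fenceStep] <;> ring

theorem skein_plain_times_doubly_notched
    (K : Type*) [CommRing K]
    (t : ℕ) (ht : 1 ≤ t) (ε : ℕ → Bool)
    (m h : ℕ) (hm : 2 ≤ m) (hh : 2 ≤ h)
    (u s v : ℕ → K) :
    -- Z(R) · Z(P)
    idealSum (natGround er 1 t) (fenceRel er t ε)
        (Sum.elim u (Sum.elim s v)) *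
      idealSum
        (natGround er 1 t ∪ natGround es 1 m ∪ natGround ee 1 h)
        (fenceRel er t ε ⊔ chainRel es 1 m ⊔ chainRel ee 1 h ⊔
          covRel (es 1) (er 1) ⊔ covRel (er 1) (es m) ⊔
          covRel (ee 1) (er t) ⊔ covRel (er t) (ee h))
        (Sum.elim u (Sum.elim s v))
    -- − Z(P_p) · Z(P_q)
    - idealSum
        (natGround er 1 t ∪ natGround es 1 m)
        (fenceRel er t ε ⊔ chainRel es 1 m ⊔
          covRel (es 1) (er 1) ⊔ covRel (er 1) (es m))
        (Sum.elim u (Sum.elim s v)) *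
      idealSum
        (natGround er 1 t ∪ natGround ee 1 h)
        (fenceRel er t ε ⊔ chainRel ee 1 h ⊔
          covRel (ee 1) (er t) ⊔ covRel (er t) (ee h))
        (Sum.elim u (Sum.elim s v))
    -- = (∏u)(1 − ∏s)(1 − ∏v)
    = (∏ i ∈ Finset.Icc 1 t, u i) *
        (1 - ∏ i ∈ Finset.Icc 1 m, s i) * (1 - ∏ j ∈ Finset.Icc 1 h, v j) := by
  set w : ℕ ⊕ (ℕ ⊕ ℕ) → K := Sum.elim u (Sum.elim s v)
  have hr : Function.Injective er := Sum.inl_injective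
  have hs : Function.Injective es := Sum.inr_injective.comp Sum.inl_injective
  have he : Function.Injective ee := Sum.inr_injective.comp Sum.inr_injective
  have hsR : ∀ i, es i ∉ natGround er 1 t := by simp [mem_natGround, er, es]
  have heR : ∀ i, ee i ∉ natGround er 1 t := by simp [mem_natGround, er, ee]
  have heRs : ∀ i, ee i ∉ natGround er 1 t ∪ natGround es 1 m := by
    simp [mem_natGround, er, es, ee]
  have h1R : er 1 ∈ natGround er 1 t := mem_natGround.2 ⟨1, le_rfl, ht, rfl⟩
  have htR : er t ∈ natGround er 1 t := mem_natGround.2 ⟨t, ht, le_rfl, rfl⟩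
  have h_fence : ∀ x y, fenceRel er t ε x y → x ∈ natGround er 1 t ∧ y ∈ natGround er 1 t := by
    rintro x y ⟨i, hi, hi', ⟨-, rfl, rfl⟩ | ⟨-, rfl, rfl⟩⟩ <;>
    exact ⟨mem_natGround.2 ⟨_, by omega, by omega, rfl⟩,
      mem_natGround.2 ⟨_, by omega, by omega, rfl⟩⟩
  have h_notched : ∀ x y, (fenceRel er t ε ⊔ chainRel es 1 m ⊔ covRel (es 1) (er 1) ⊔
      covRel (er 1) (es m)) x y →
      x ∈ natGround er 1 t ∪ natGround es 1 m ∧ y ∈ natGround er 1 t ∪ natGround es 1 m := by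
    have hsm : ∀ i, 1 ≤ i → i ≤ m → es i ∈ natGround er 1 t ∪ natGround es 1 m :=
      fun i h1 h2 => Finset.mem_union_right _ (mem_natGround.2 ⟨i, h1, h2, rfl⟩)
    rintro x y (((hxy | ⟨i, hi, hi', rfl, rfl⟩) | ⟨rfl, rfl⟩) | ⟨rfl, rfl⟩)
    · exact ⟨Finset.mem_union_left _ (h_fence x y hxy).1,
        Finset.mem_union_left _ (h_fence x y hxy).2⟩
    · exact ⟨hsm _ hi (by omega), hsm _ (by omega) hi'⟩
    · exact ⟨hsm _ le_rfl (by omega), Finset.mem_union_left _ h1R⟩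
    · exact ⟨Finset.mem_union_left _ h1R, hsm _ (by omega) le_rfl⟩
  have h_rel : fenceRel er t ε ⊔ chainRel es 1 m ⊔ chainRel ee 1 h ⊔
          covRel (es 1) (er 1) ⊔ covRel (er 1) (es m) ⊔
          covRel (ee 1) (er t) ⊔ covRel (er t) (ee h) =
      (fenceRel er t ε ⊔ chainRel es 1 m ⊔ covRel (es 1) (er 1) ⊔ covRel (er 1) (es m)) ⊔
        chainRel ee 1 h ⊔ covRel (ee 1) (er t) ⊔ covRel (er t) (ee h) := by
    ac_rfl
  have hφ : ∀ S ⊆ natGround er 1 t, ∀ T ⊆ natGround es 1 m,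
      loopSum ee h w (er t ∈ S ∪ T) * 1 = loopSum ee h w (er t ∈ S) * 1 := by
    intro S _ T hT
    have : er t ∉ T := fun hx => by
      obtain ⟨i, -, -, hi⟩ := mem_natGround.1 (hT hx)
      simp [er, es] at hi
    simp only [Finset.mem_union, this, or_false]
  rw [h_rel]
  simp only [idealSum_eq_weightedIdealSum]
  rw [weightedIdealSum_union_loop w _ (by omega) h_notched (Finset.mem_union_left _ htR) heRs
      (fun _ _ _ _ => rfl),
    weightedIdealSum_union_loop w _ (by omega) h_fence h1R hsR hφ,
    weightedIdealSum_union_loop w _ (by omega) h_fence h1R hsR (fun _ _ _ _ => rfl),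
    weightedIdealSum_union_loop w _ (by omega) h_fence htR heR (fun _ _ _ _ => rfl)]
  have det := fenceSum_det hr ht ε w (loopSum es m w) (fun _ => 1) (loopSum ee h w) (fun _ => 1)
  have hσ := loopSum_false_sub_true hs (m := m) (by omega) w
  have hη := loopSum_false_sub_true he (m := h) (by omega) w
  simp only [fenceSum, mul_one, one_mul, hσ, hη] at det ⊢
  rw [mul_comm (weightedIdealSum _ _ w fun _ => 1)]
  exact det
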